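/- arXiv:2601.08456 — 2 statements merged into one kernel-verified Lean document; each statement's English description precedes it below -/
import Mathlib

section
/- For real x and q with 0 ≤ q < 1 and |x| < 1, the Rogers–Fine type identity holds: ∑_{n=0}^∞ x^n q^{n(n+1)/2} = ∑_{n=0}^∞ (xq; q^2)_n / (xq^2; q^2)_n · (xq)^n, where (a;q)_m = ∏_{k=0}^{m-1}(1 - a q^k). -/
/-- The general term of the right-hand series of the Rogers–Fine type identity. -/
noncomputable def rogersFineTerm (q x : ℝ) (n : ℕ) : ℝ :=
  (∏ k ∈ Finset.range n, (1 - x * q * (q ^ 2) ^ k)) /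
    (∏ k ∈ Finset.range n, (1 - x * q ^ 2 * (q ^ 2) ^ k)) * (x * q) ^ n

/-- The general term of the partial theta series. -/
def partialThetaTerm (q x : ℝ) (n : ℕ) : ℝ := x ^ n * q ^ (n * (n + 1) / 2)

theorem one_sub_mul_pos_of_abs_lt_one {x a : ℝ} (hx : |x| < 1) (ha0 : 0 ≤ a) (ha1 : a ≤ 1) :
    0 < 1 - x * a := by
  have h := abs_lt.mp hx
  nlinarith

section

variable {q x : ℝ}

theorem rogersFineTerm_succ (hq0 : 0 ≤ q) (hq1 : q < 1) (hx : |x| < 1) (n : ℕ) :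
    (1 - x * q ^ 2 * (q ^ 2) ^ n) * rogersFineTerm q x (n + 1) =
      x * q * (1 - x * q * (q ^ 2) ^ n) * rogersFineTerm q x n := by
  have h : ∀ k : ℕ, 1 - x * q ^ 2 * (q ^ 2) ^ k ≠ 0 := fun k ↦ by
    have := one_sub_mul_pos_of_abs_lt_one (a := (q ^ 2) ^ (k + 1)) hx (by positivity)
      (pow_le_one₀ (by positivity) (pow_le_one₀ hq0 hq1.le))
    rw [pow_succ', ← mul_assoc] at this
    exact this.ne'
  have hP : ∏ k ∈ Finset.range n, (1 - x * q ^ 2 * (q ^ 2) ^ k) ≠ 0 :=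
    Finset.prod_ne_zero_iff.mpr fun k _ ↦ h k
  have hn := h n
  unfold rogersFineTerm
  rw [Finset.prod_range_succ, Finset.prod_range_succ]
  generalize 1 - x * q ^ 2 * (q ^ 2) ^ n = b at *
  generalize ∏ k ∈ Finset.range n, (1 - x * q ^ 2 * (q ^ 2) ^ k) = B at *
  field_simp
  ring

theorem abs_rogersFineTerm_le (hq0 : 0 ≤ q) (hq1 : q < 1) (hx : |x| < 1) (n : ℕ) :
    |rogersFineTerm q x n| ≤ |x| ^ n := by
  induction n with
  | zero => simp [rogersFineTerm]
  | succ n ih =>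
    have hy0 : 0 ≤ (q ^ 2) ^ n := by positivity
    have hy1 : (q ^ 2) ^ n ≤ 1 := pow_le_one₀ (by positivity) (pow_le_one₀ hq0 hq1.le)
    have hs := rogersFineTerm_succ hq0 hq1 hx n
    generalize (q ^ 2) ^ n = y at *
    have hqy : q * y ≤ 1 := mul_le_one₀ hq1.le hy0 hy1
    have ha := one_sub_mul_pos_of_abs_lt_one hx (mul_nonneg hq0 hy0) hqy
    have hb := one_sub_mul_pos_of_abs_lt_one hx (mul_nonneg hq0 (mul_nonneg hq0 hy0))
      (mul_le_one₀ hq1.le (mul_nonneg hq0 hy0) hqy)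
    rw [show x * (q * y) = x * q * y by ring] at ha
    rw [show x * (q * (q * y)) = x * q ^ 2 * y by ring] at hb
    have hs' := congrArg abs hs
    rw [abs_mul, abs_mul, abs_mul, abs_mul, abs_of_pos hb, abs_of_pos ha, abs_of_nonneg hq0] at hs'
    refine le_of_mul_le_mul_left ?_ hb
    rw [hs', pow_succ]
    have h1 : q * (1 - x * q * y) ≤ 1 - x * q ^ 2 * y := by nlinarith
    calc |x| * q * (1 - x * q * y) * |rogersFineTerm q x n|
        = |x| * |rogersFineTerm q x n| * (q * (1 - x * q * y)) := by ring
      _ ≤ |x| * |x| ^ n * (1 - x * q ^ 2 * y) := by gcongr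
      _ = _ := by ring

theorem abs_partialThetaTerm_le (hq0 : 0 ≤ q) (hq1 : q < 1) (n : ℕ) :
    |partialThetaTerm q x n| ≤ |x| ^ n := by
  rw [partialThetaTerm, abs_mul, abs_pow, abs_of_nonneg (pow_nonneg hq0 _)]
  exact mul_le_of_le_one_right (by positivity) (pow_le_one₀ hq0 hq1.le)

theorem summable_rogersFineTerm (hq0 : 0 ≤ q) (hq1 : q < 1) (hx : |x| < 1) :
    Summable (rogersFineTerm q x) :=
  .of_norm_bounded (summable_geometric_of_lt_one (abs_nonneg x) hx)
    (abs_rogersFineTerm_le hq0 hq1 hx)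

theorem summable_partialThetaTerm (hq0 : 0 ≤ q) (hq1 : q < 1) (hx : |x| < 1) :
    Summable (partialThetaTerm q x) :=
  .of_norm_bounded (summable_geometric_of_lt_one (abs_nonneg x) hx)
    (abs_partialThetaTerm_le hq0 hq1)

theorem abs_mul_le_of_le_one {a : ℝ} (ha0 : 0 ≤ a) (ha1 : a ≤ 1) : |x * a| ≤ |x| := by
  rw [abs_mul, abs_of_nonneg ha0]
  exact mul_le_of_le_one_right (abs_nonneg x) ha1

theorem tsum_partialThetaTerm_eq (hq0 : 0 ≤ q) (hq1 : q < 1) (hx : |x| < 1) :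
    ∑' n, partialThetaTerm q x n = 1 + x * q * ∑' n, partialThetaTerm q (x * q) n := by
  rw [(summable_partialThetaTerm hq0 hq1 hx).tsum_eq_zero_add, ← tsum_mul_left]
  congr 1
  · simp [partialThetaTerm]
  · refine tsum_congr fun n ↦ ?_
    have h : (n + 1) * (n + 1 + 1) / 2 = n * (n + 1) / 2 + (n + 1) := by
      rw [show (n + 1) * (n + 1 + 1) = n * (n + 1) + (n + 1) * 2 by ring]
      omega
    simp only [partialThetaTerm, h]
    ring

theorem rogersFineTerm_mul_sq (hq0 : 0 ≤ q) (hq1 : q < 1) (hx : |x| < 1) (n : ℕ) :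
    (1 - x * q) * (x * q) * rogersFineTerm q (x * q ^ 2) n =
      (q ^ 2) ^ n * (1 - x * q ^ 2) * rogersFineTerm q x (n + 1) := by
  have hq2 : q ^ 2 ≤ 1 := pow_le_one₀ hq0 hq1.le
  have hx' : |x * q ^ 2| < 1 := (abs_mul_le_of_le_one (by positivity) hq2).trans_lt hx
  induction n with
  | zero =>
    have h := rogersFineTerm_succ hq0 hq1 hx 0
    simp only [rogersFineTerm, Finset.range_zero, Finset.prod_empty, pow_zero, mul_one,
      div_one] at h ⊢
    linear_combination -h
  | succ n ih =>
    have h₁ := rogersFineTerm_succ hq0 hq1 hx' n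
    have h₂ := rogersFineTerm_succ hq0 hq1 hx (n + 1)
    have hb := one_sub_mul_pos_of_abs_lt_one (a := q ^ 2 * (q ^ 2) ^ n) hx' (by positivity)
      (mul_le_one₀ hq2 (by positivity) (pow_le_one₀ (by positivity) hq2))
    rw [pow_succ (q ^ 2) n] at h₂ ⊢
    generalize (q ^ 2) ^ n = y at *
    refine mul_left_cancel₀ hb.ne' ?_
    linear_combination (1 - x * q) * (x * q) * h₁ + x * q ^ 3 * (1 - x * q ^ 3 * y) * ih
      - y * q ^ 2 * (1 - x * q ^ 2) * h₂

theorem sum_rogersFineTerm_sub (hq0 : 0 ≤ q) (hq1 : q < 1) (hx : |x| < 1) (N : ℕ) :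
    ∑ n ∈ Finset.range N, (1 - x * q) *
        (rogersFineTerm q x n - x ^ 2 * q ^ 3 * rogersFineTerm q (x * q ^ 2) n) =
      (1 - x ^ 2 * q ^ 2) - (1 - x ^ 2 * q ^ 2 * (q ^ 2) ^ N) * rogersFineTerm q x N := by
  induction N with
  | zero => simp [rogersFineTerm]
  | succ n ih =>
    rw [Finset.sum_range_succ, ih]
    have h₁ := rogersFineTerm_mul_sq hq0 hq1 hx n
    have h₂ := rogersFineTerm_succ hq0 hq1 hx n
    rw [pow_succ (q ^ 2) n]
    generalize (q ^ 2) ^ n = y at *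
    linear_combination -x * q ^ 2 * h₁ + h₂

theorem tsum_rogersFineTerm_eq (hq0 : 0 ≤ q) (hq1 : q < 1) (hx : |x| < 1) :
    ∑' n, rogersFineTerm q x n =
      1 + x * q + x ^ 2 * q ^ 3 * ∑' n, rogersFineTerm q (x * q ^ 2) n := by
  have hq2 : q ^ 2 < 1 := pow_lt_one₀ hq0 hq1 two_ne_zero
  have hx' : |x * q ^ 2| < 1 := (abs_mul_le_of_le_one (by positivity) hq2.le).trans_lt hx
  have hS := summable_rogersFineTerm hq0 hq1 hx
  have h₁ := ((hS.hasSum.sub ((summable_rogersFineTerm hq0 hq1 hx').hasSum.mul_left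
    (x ^ 2 * q ^ 3))).mul_left (1 - x * q)).tendsto_sum_nat
  simp only [sum_rogersFineTerm_sub hq0 hq1 hx] at h₁
  have h₂ := (((tendsto_pow_atTop_nhds_zero_of_lt_one (by positivity) hq2).const_mul
    (x ^ 2 * q ^ 2)).const_sub 1).mul hS.tendsto_atTop_zero |>.const_sub (1 - x ^ 2 * q ^ 2)
  have h := tendsto_nhds_unique h₁ h₂
  refine mul_left_cancel₀ (one_sub_mul_pos_of_abs_lt_one hx hq0 hq1.le).ne' ?_
  linear_combination h

theorem abs_tsum_sub_tsum_le {r : ℝ} (hq0 : 0 ≤ q) (hq1 : q < 1) (hr : r < 1) (n : ℕ) :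
    ∀ x : ℝ, |x| ≤ r →
      |∑' k, partialThetaTerm q x k - ∑' k, rogersFineTerm q x k| ≤
        (r ^ 2) ^ n * ((1 - r)⁻¹ + (1 - r)⁻¹) := by
  induction n with
  | zero =>
    intro x hxr
    have hx := hxr.trans_lt hr
    have hg : (1 - |x|)⁻¹ ≤ (1 - r)⁻¹ := by
      have : 0 < 1 - r := sub_pos.mpr hr
      gcongr
    have h₁ := tsum_of_norm_bounded (f := partialThetaTerm q x)
      (hasSum_geometric_of_lt_one (abs_nonneg x) hx)
      (abs_partialThetaTerm_le (x := x) hq0 hq1)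
    have h₂ := tsum_of_norm_bounded (f := rogersFineTerm q x)
      (hasSum_geometric_of_lt_one (abs_nonneg x) hx)
      (abs_rogersFineTerm_le hq0 hq1 hx)
    rw [pow_zero, one_mul]
    exact (abs_sub _ _).trans (add_le_add (h₁.trans hg) (h₂.trans hg))
  | succ n ih =>
    intro x hxr
    have hx := hxr.trans_lt hr
    have hxq := abs_mul_le_of_le_one (x := x) hq0 hq1.le
    have hxq2 := abs_mul_le_of_le_one (x := x) (sq_nonneg q) (pow_le_one₀ hq0 hq1.le)
    have hD := ih _ (hxq2.trans hxr)
    have hc : |x ^ 2 * q ^ 3| ≤ r ^ 2 := by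
      refine (abs_mul_le_of_le_one (by positivity) (pow_le_one₀ hq0 hq1.le)).trans ?_
      rw [abs_pow]
      gcongr
    have hθ := tsum_partialThetaTerm_eq hq0 hq1 (hxq.trans_lt hx)
    rw [mul_assoc x q q, ← sq] at hθ
    rw [tsum_partialThetaTerm_eq hq0 hq1 hx, tsum_rogersFineTerm_eq hq0 hq1 hx, hθ]
    generalize ∑' k, partialThetaTerm q (x * q ^ 2) k = A at *
    generalize ∑' k, rogersFineTerm q (x * q ^ 2) k = B at *
    rw [show 1 + x * q * (1 + x * q ^ 2 * A) - (1 + x * q + x ^ 2 * q ^ 3 * B) =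
      x ^ 2 * q ^ 3 * (A - B) by ring, abs_mul, pow_succ' (r ^ 2),
      mul_assoc (r ^ 2)]
    gcongr

end

theorem rogers_fine_identity (x q : ℝ) (hq0 : 0 ≤ q) (hq1 : q < 1) (hx : |x| < 1) :
    ∑' n : ℕ, x ^ n * q ^ (n * (n + 1) / 2) =
      ∑' n : ℕ, (∏ k ∈ Finset.range n, (1 - x * q * (q ^ 2) ^ k)) /
        (∏ k ∈ Finset.range n, (1 - x * q ^ 2 * (q ^ 2) ^ k)) * (x * q) ^ n := by
  have hlim := (tendsto_pow_atTop_nhds_zero_of_lt_one (sq_nonneg |x|)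
    (pow_lt_one₀ (abs_nonneg x) hx two_ne_zero)).mul_const ((1 - |x|)⁻¹ + (1 - |x|)⁻¹)
  rw [zero_mul] at hlim
  have h := ge_of_tendsto' hlim fun n ↦ abs_tsum_sub_tsum_le hq0 hq1 hx n x le_rfl
  exact sub_eq_zero.mp (abs_nonpos_iff.mp h)
end

section
/- For real q with 0 ≤ q < 1, ∑_{n=0}^∞ q^n (q;q^2)_n = ∑_{n=0}^∞ (-1)^n q^{n(n+1)} / (q;q^2)_{n+1}, where (q;q^2)_m = ∏_{k=0}^{m-1}(1 - q^{1+2k}). -/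
open Filter Topology

/-- The finite `q`-Pochhammer product `(q; q²)ₙ`. -/
def oddPochhammer (q : ℝ) (n : ℕ) : ℝ := ∏ k ∈ Finset.range n, (1 - q ^ (1 + 2 * k))

/-- The power series `∑ zⁿ (q; q²)ₙ`. -/
noncomputable def oddPochhammerSeries (q z : ℝ) : ℝ := ∑' n : ℕ, z ^ n * oddPochhammer q n

lemma oddPochhammer_succ (q : ℝ) (n : ℕ) :
    oddPochhammer q (n + 1) = oddPochhammer q n * (1 - q ^ (1 + 2 * n)) :=
  Finset.prod_range_succ _ n

section

variable {q z : ℝ}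

lemma oddPochhammer_pos (hq0 : 0 ≤ q) (hq1 : q < 1) (n : ℕ) : 0 < oddPochhammer q n :=
  Finset.prod_pos fun _ _ ↦ sub_pos.2 (pow_lt_one₀ hq0 hq1 (by omega))

lemma oddPochhammer_le_one (hq0 : 0 ≤ q) (hq1 : q < 1) (n : ℕ) : oddPochhammer q n ≤ 1 :=
  Finset.prod_le_one (fun _ _ ↦ sub_nonneg.2 (pow_le_one₀ hq0 hq1.le))
    fun _ _ ↦ sub_le_self _ (pow_nonneg hq0 _)

lemma pow_mul_oddPochhammer_le (hq0 : 0 ≤ q) (hq1 : q < 1) (hz0 : 0 ≤ z) (n : ℕ) :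
    z ^ n * oddPochhammer q n ≤ z ^ n :=
  mul_le_of_le_one_right (pow_nonneg hz0 n) (oddPochhammer_le_one hq0 hq1 n)

lemma summable_pow_mul_oddPochhammer (hq0 : 0 ≤ q) (hq1 : q < 1) (hz0 : 0 ≤ z) (hz1 : z < 1) :
    Summable fun n : ℕ ↦ z ^ n * oddPochhammer q n :=
  .of_nonneg_of_le (fun n ↦ mul_nonneg (pow_nonneg hz0 n) (oddPochhammer_pos hq0 hq1 n).le)
    (pow_mul_oddPochhammer_le hq0 hq1 hz0) (summable_geometric_of_lt_one hz0 hz1)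

lemma oddPochhammerSeries_nonneg (hq0 : 0 ≤ q) (hq1 : q < 1) (hz0 : 0 ≤ z) :
    0 ≤ oddPochhammerSeries q z :=
  tsum_nonneg fun n ↦ mul_nonneg (pow_nonneg hz0 n) (oddPochhammer_pos hq0 hq1 n).le

lemma oddPochhammerSeries_le (hq0 : 0 ≤ q) (hq1 : q < 1) (hz0 : 0 ≤ z) (hz1 : z < 1) :
    oddPochhammerSeries q z ≤ (1 - z)⁻¹ := by
  rw [← tsum_geometric_of_lt_one hz0 hz1]
  exact (summable_pow_mul_oddPochhammer hq0 hq1 hz0 hz1).tsum_le_tsum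
    (pow_mul_oddPochhammer_le hq0 hq1 hz0) (summable_geometric_of_lt_one hz0 hz1)

lemma one_sub_mul_oddPochhammerSeries (hq0 : 0 ≤ q) (hq1 : q < 1) (hz0 : 0 ≤ z) (hz1 : z < 1) :
    (1 - z) * oddPochhammerSeries q z = 1 - q * z * oddPochhammerSeries q (q ^ 2 * z) := by
  have hs := summable_pow_mul_oddPochhammer hq0 hq1 hz0 hz1
  have hs' : Summable fun n : ℕ ↦ (q ^ 2 * z) ^ n * oddPochhammer q n :=
    summable_pow_mul_oddPochhammer hq0 hq1 (by positivity)
      (mul_lt_one_of_nonneg_of_lt_one_right (pow_le_one₀ hq0 hq1.le) hz0 hz1)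
  have hstep : ∑' n : ℕ, z ^ (n + 1) * oddPochhammer q (n + 1) =
      z * oddPochhammerSeries q z - q * z * oddPochhammerSeries q (q ^ 2 * z) := by
    simp only [oddPochhammerSeries]
    rw [← tsum_mul_left, ← tsum_mul_left, ← (hs.mul_left z).tsum_sub (hs'.mul_left (q * z))]
    refine tsum_congr fun n ↦ ?_
    rw [oddPochhammer_succ]
    ring
  have hzero : oddPochhammerSeries q z = 1 + ∑' n : ℕ, z ^ (n + 1) * oddPochhammer q (n + 1) := by
    rw [oddPochhammerSeries, hs.tsum_eq_zero_add]
    simp [oddPochhammer]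
  linear_combination hzero + hstep

lemma oddPochhammerSeries_eq_sum_add (hq0 : 0 ≤ q) (hq1 : q < 1) (N : ℕ) :
    oddPochhammerSeries q q =
      ∑ n ∈ Finset.range N, (-1 : ℝ) ^ n * q ^ (n * (n + 1)) / oddPochhammer q (n + 1) +
        (-1 : ℝ) ^ N * q ^ (N * (N + 1)) / oddPochhammer q (N + 1) *
          ((1 - q ^ (1 + 2 * N)) * oddPochhammerSeries q (q ^ (1 + 2 * N))) := by
  induction N with
  | zero =>
    have : 1 - q ≠ 0 := (sub_pos.2 hq1).ne'
    simp [oddPochhammer]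
    field_simp
  | succ N ih =>
    have h := one_sub_mul_oddPochhammerSeries hq0 hq1 (pow_nonneg hq0 (1 + 2 * N))
      (pow_lt_one₀ hq0 hq1 (by omega))
    have hexp : q ^ 2 * q ^ (1 + 2 * N) = q ^ (1 + 2 * (N + 1)) := by ring
    rw [ih, h, hexp, Finset.sum_range_succ, oddPochhammer_succ q (N + 1)]
    have := (oddPochhammer_pos hq0 hq1 (N + 1)).ne'
    have : 1 - q ^ (1 + 2 * (N + 1)) ≠ 0 := (sub_pos.2 (pow_lt_one₀ hq0 hq1 (by omega))).ne'
    field_simp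
    ring

lemma summable_neg_one_pow_mul_pow_div_oddPochhammer (hq0 : 0 ≤ q) (hq1 : q < 1) :
    Summable fun n : ℕ ↦ (-1 : ℝ) ^ n * q ^ (n * (n + 1)) / oddPochhammer q (n + 1) := by
  have hsmall : ∀ᶠ n : ℕ in atTop, q ^ n < 1 / 3 :=
    (tendsto_pow_atTop_nhds_zero_of_lt_one hq0 hq1).eventually_lt_const (by norm_num)
  refine summable_of_ratio_norm_eventually_le (r := 1 / 2) (by norm_num) ?_
  filter_upwards [hsmall] with n hn
  have hP := oddPochhammer_pos hq0 hq1 (n + 1)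
  have h₁ : q ^ (2 * n + 2) < 1 / 3 := (pow_le_pow_of_le_one hq0 hq1.le (by omega)).trans_lt hn
  have h₂ : q ^ (1 + 2 * (n + 1)) < 1 / 3 :=
    (pow_le_pow_of_le_one hq0 hq1.le (by omega)).trans_lt hn
  have h₃ : 0 < 1 - q ^ (1 + 2 * (n + 1)) := by linarith
  have hratio : q ^ (2 * n + 2) / (1 - q ^ (1 + 2 * (n + 1))) ≤ 1 / 2 := by
    rw [div_le_iff₀ h₃]
    linarith
  have hsucc : (-1 : ℝ) ^ (n + 1) * q ^ ((n + 1) * (n + 1 + 1)) / oddPochhammer q (n + 1 + 1) =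
      -(q ^ (2 * n + 2) / (1 - q ^ (1 + 2 * (n + 1)))) *
        ((-1 : ℝ) ^ n * q ^ (n * (n + 1)) / oddPochhammer q (n + 1)) := by
    rw [oddPochhammer_succ q (n + 1)]
    field_simp
    ring
  rw [hsucc, norm_mul, norm_neg, Real.norm_of_nonneg (by positivity)]
  gcongr

end

theorem pochhammer_series_kappa_two (q : ℝ) (hq0 : 0 ≤ q) (hq1 : q < 1) :
    ∑' n : ℕ, q ^ n * ∏ k ∈ Finset.range n, (1 - q ^ (1 + 2 * k)) =
      ∑' n : ℕ, (-1 : ℝ) ^ n * q ^ (n * (n + 1)) /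
        ∏ k ∈ Finset.range (n + 1), (1 - q ^ (1 + 2 * k)) := by
  have hs := summable_neg_one_pow_mul_pow_div_oddPochhammer hq0 hq1
  have hrem : Tendsto (fun N : ℕ ↦ (-1 : ℝ) ^ N * q ^ (N * (N + 1)) / oddPochhammer q (N + 1) *
      ((1 - q ^ (1 + 2 * N)) * oddPochhammerSeries q (q ^ (1 + 2 * N)))) atTop (𝓝 0) := by
    refine squeeze_zero_norm (fun N ↦ ?_) (tendsto_zero_iff_norm_tendsto_zero.1
      hs.tendsto_atTop_zero)
    have hz0 : 0 ≤ q ^ (1 + 2 * N) := pow_nonneg hq0 _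
    have hz1 : 0 < 1 - q ^ (1 + 2 * N) := sub_pos.2 (pow_lt_one₀ hq0 hq1 (by omega))
    have hle := oddPochhammerSeries_le hq0 hq1 hz0 (sub_pos.1 hz1)
    rw [norm_mul, Real.norm_of_nonneg
      (mul_nonneg hz1.le (oddPochhammerSeries_nonneg hq0 hq1 hz0))]
    refine mul_le_of_le_one_right (norm_nonneg _) ?_
    calc _ ≤ (1 - q ^ (1 + 2 * N)) * (1 - q ^ (1 + 2 * N))⁻¹ := by gcongr
      _ = 1 := mul_inv_cancel₀ hz1.ne'
  have hlim := hs.hasSum.tendsto_sum_nat.add hrem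
  simp only [← oddPochhammerSeries_eq_sum_add hq0 hq1, add_zero] at hlim
  exact tendsto_nhds_unique tendsto_const_nhds hlim
end
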